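/- arXiv:2101.09152 — 6 statements merged into one kernel-verified Lean document; each statement's English description precedes it below -/
import Mathlib

section
/- Let H and V be finite-dimensional real normed vector spaces, with V a real inner product space with inner product ⟨·,·⟩. Let a : H × H → ℝ and c : V × V → ℝ be symmetric positive semidefinite bilinear forms with seminorms ‖τ‖_a := a(τ,τ)^{1/2}, ‖w‖_c := c(w,w)^{1/2}, let b : V × H → ℝ be bilinear, let T > 0 and let f : [0,T] → V be continuous. Suppose (σ, v), (σ̂, v̂), (σ_h, v_h) : [0,T] → H × V are continuously differentiable and satisfy, for all t ∈ [0,T], τ ∈ H, w ∈ V: (i) a(σ'(t),τ) + a(σ(t),τ) + b(v(t),τ) = 0 and c(v'(t),w) − b(w,σ(t)) = ⟨f(t),w⟩; (ii) a(σ̂(t),τ) + b(v̂(t),τ) = −a(σ'(t),τ) and b(w, σ̂(t)) = c(v'(t),w) − ⟨f(t),w⟩; (iii) a(σ_h'(t),τ) + a(σ_h(t),τ) + b(v_h(t),τ) = 0 and c(v_h'(t),w) − b(w,σ_h(t)) = ⟨f(t),w⟩. Then for every t ∈ [0,T]: ‖σ̂(t) − σ_h(t)‖_a² + ‖v̂(t)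 − v_h(t)‖_c² ≤ e^T · ( ‖σ̂(0) − σ_h(0)‖_a² + ‖v̂(0) − v_h(0)‖_c² + ∫₀^T [ ‖σ̂'(s) − σ'(s)‖_a² + ‖v̂'(s) − v'(s)‖_c² ] ds ). -/
open scoped RealInnerProductSpace

/-- A bilinear form on a finite-dimensional space, evaluated on the diagonal along a
differentiable curve, obeys the product rule. -/
theorem LinearMap.hasDerivWithinAt_apply_self {E : Type*} [NormedAddCommGroup E]
    [NormedSpace ℝ E] [FiniteDimensional ℝ E] (B : E →ₗ[ℝ] E →ₗ[ℝ] ℝ)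
    (hB : ∀ x y, B x y = B y x) {x : ℝ → E} {x' : E} {s : Set ℝ} {t : ℝ}
    (hx : HasDerivWithinAt x x' s t) :
    HasDerivWithinAt (fun r => B (x r) (x r)) (2 * B x' (x t)) s t := by
  have h := B.toContinuousBilinearMap.hasDerivWithinAt_of_bilinear hx hx
  refine h.congr_deriv ?_
  rw [toContinuousBilinearMap_apply, toContinuousBilinearMap_apply, hB (x t) x', two_mul]

theorem LinearMap.continuousOn_apply_self {E : Type*} [NormedAddCommGroup E]
    [NormedSpace ℝ E] [FiniteDimensional ℝ E] (B : E →ₗ[ℝ] E →ₗ[ℝ] ℝ)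
    {x : ℝ → E} {s : Set ℝ} (hx : ContinuousOn x s) :
    ContinuousOn (fun r => B (x r) (x r)) s := by
  have h : ContinuousOn (fun r => B.toContinuousBilinearMap (x r) (x r)) s := by fun_prop
  simpa using h

/-- Young's inequality for a symmetric positive semidefinite bilinear form. -/
theorem LinearMap.two_mul_apply_le_add_apply_self {E : Type*} [AddCommGroup E] [Module ℝ E]
    (B : E →ₗ[ℝ] E →ₗ[ℝ] ℝ) (hB : ∀ x y, B x y = B y x) (hnonneg : ∀ x, 0 ≤ B x x) (x y : E) :
    2 * B x y ≤ B x x + B y y := by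
  have h := hnonneg (x - y)
  simp only [map_sub, LinearMap.sub_apply] at h
  linarith [hB x y]

/-- Grönwall's inequality with an integrated nonnegative source term. -/
theorem le_exp_mul_add_integral_of_deriv_le {T : ℝ} {E E' P : ℝ → ℝ}
    (hE : ∀ t ∈ Set.Icc (0 : ℝ) T, HasDerivWithinAt E (E' t) (Set.Icc 0 T) t)
    (hP : ContinuousOn P (Set.Icc 0 T)) (hP0 : ∀ t ∈ Set.Icc (0 : ℝ) T, 0 ≤ P t)
    (hE' : ∀ t ∈ Set.Icc (0 : ℝ) T, E' t ≤ E t + P t) {t : ℝ} (ht : t ∈ Set.Icc (0 : ℝ) T) :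
    E t ≤ Real.exp t * (E 0 + ∫ s in (0 : ℝ)..t, P s) := by
  have hT : 0 ≤ T := ht.1.trans ht.2
  have hPint : IntervalIntegrable P MeasureTheory.volume 0 T :=
    ContinuousOn.intervalIntegrable (by rwa [Set.uIcc_of_le hT])
  have hanti : AntitoneOn (fun r => Real.exp (-r) * E r - ∫ s in (0 : ℝ)..r, P s)
      (Set.Icc 0 T) := by
    refine antitoneOn_of_hasDerivWithinAt_nonpos (convex_Icc 0 T) ?_
      (f' := fun r => (Real.exp (-r) * (-1) * E r + Real.exp (-r) * E' r) - P r) ?_ ?_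
    · refine ContinuousOn.sub (ContinuousOn.mul (by fun_prop)
        fun r hr => (hE r hr).continuousWithinAt) ?_
      have h := intervalIntegral.continuousOn_primitive_interval' hPint Set.left_mem_uIcc
      rwa [Set.uIcc_of_le hT] at h
    · intro r hr
      rw [interior_Icc] at hr
      have hr' := Set.Ioo_subset_Icc_self hr
      have hnhds : Set.Icc 0 T ∈ nhds r := Icc_mem_nhds hr.1 hr.2
      have hint : HasDerivAt (fun r => ∫ s in (0 : ℝ)..r, P s) (P r) r :=
        intervalIntegral.integral_hasDerivAt_right
          (hPint.mono_set (by
            rw [Set.uIcc_of_le hr'.1, Set.uIcc_of_le hT]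
            exact Set.Icc_subset_Icc_right hr'.2))
          ((hP.mono Set.Ioo_subset_Icc_self).stronglyMeasurableAtFilter isOpen_Ioo r hr)
          (hP.continuousAt hnhds)
      exact (((hasDerivAt_neg r).exp.mul ((hE r hr').hasDerivAt hnhds)).sub hint).hasDerivWithinAt
    · intro r hr
      have hr' := interior_subset hr
      have hexp : Real.exp (-r) ≤ 1 := Real.exp_le_one_iff.2 (by linarith [hr'.1])
      nlinarith [mul_le_mul_of_nonneg_left (hE' r hr') (Real.exp_nonneg (-r)),
        mul_le_mul_of_nonneg_right hexp (hP0 r hr')]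
  have h := hanti (Set.left_mem_Icc.2 hT) ht ht.1
  simp only [neg_zero, Real.exp_zero, one_mul, intervalIntegral.integral_same, sub_zero] at h
  calc E t = Real.exp t * (Real.exp (-t) * E t) := by
        rw [← mul_assoc, ← Real.exp_add, add_neg_cancel, Real.exp_zero, one_mul]
    _ ≤ _ := by gcongr; linarith

/-- Abstract form of the semi-discrete error estimate (Theorem 3.1):
the finite element error, measured against the elliptic projection,
is controlled by the projection error of the time derivatives. -/
theorem semidiscrete_error_estimate
    {H V : Type*} [NormedAddCommGroup H] [NormedSpace ℝ H] [FiniteDimensional ℝ H]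
    [NormedAddCommGroup V] [InnerProductSpace ℝ V] [FiniteDimensional ℝ V]
    (a : H →ₗ[ℝ] H →ₗ[ℝ] ℝ) (c : V →ₗ[ℝ] V →ₗ[ℝ] ℝ) (b : V →ₗ[ℝ] H →ₗ[ℝ] ℝ)
    (ha_symm : ∀ x y, a x y = a y x) (ha_nonneg : ∀ x, 0 ≤ a x x)
    (hc_symm : ∀ x y, c x y = c y x) (hc_nonneg : ∀ x, 0 ≤ c x x)
    (T : ℝ) (hT : 0 < T) (f : ℝ → V) (hf : ContinuousOn f (Set.Icc 0 T))
    (σ σhat σh : ℝ → H) (v vhat vh : ℝ → V)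
    (σ' σhat' σh' : ℝ → H) (v' vhat' vh' : ℝ → V)
    (hσ : ∀ t ∈ Set.Icc (0:ℝ) T, HasDerivWithinAt σ (σ' t) (Set.Icc 0 T) t)
    (hσhat : ∀ t ∈ Set.Icc (0:ℝ) T, HasDerivWithinAt σhat (σhat' t) (Set.Icc 0 T) t)
    (hσh : ∀ t ∈ Set.Icc (0:ℝ) T, HasDerivWithinAt σh (σh' t) (Set.Icc 0 T) t)
    (hv : ∀ t ∈ Set.Icc (0:ℝ) T, HasDerivWithinAt v (v' t) (Set.Icc 0 T) t)
    (hvhat : ∀ t ∈ Set.Icc (0:ℝ) T, HasDerivWithinAt vhat (vhat' t) (Set.Icc 0 T) t)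
    (hvh : ∀ t ∈ Set.Icc (0:ℝ) T, HasDerivWithinAt vh (vh' t) (Set.Icc 0 T) t)
    (hσ' : ContinuousOn σ' (Set.Icc 0 T)) (hσhat' : ContinuousOn σhat' (Set.Icc 0 T))
    (hσh' : ContinuousOn σh' (Set.Icc 0 T)) (hv' : ContinuousOn v' (Set.Icc 0 T))
    (hvhat' : ContinuousOn vhat' (Set.Icc 0 T)) (hvh' : ContinuousOn vh' (Set.Icc 0 T))
    -- (i) the exact solution of the weak problem
    (hweak1 : ∀ t ∈ Set.Icc (0:ℝ) T, ∀ τ : H, a (σ' t) τ + a (σ t) τ + b (v t) τ = 0)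
    (hweak2 : ∀ t ∈ Set.Icc (0:ℝ) T, ∀ w : V, c (v' t) w - b w (σ t) = ⟪f t, w⟫)
    -- (ii) the elliptic projection
    (hproj1 : ∀ t ∈ Set.Icc (0:ℝ) T, ∀ τ : H, a (σhat t) τ + b (vhat t) τ = -(a (σ' t) τ))
    (hproj2 : ∀ t ∈ Set.Icc (0:ℝ) T, ∀ w : V, b w (σhat t) = c (v' t) w - ⟪f t, w⟫)
    -- (iii) the semi-discrete finite element solution
    (hsemi1 : ∀ t ∈ Set.Icc (0:ℝ) T, ∀ τ : H, a (σh' t) τ + a (σh t) τ + b (vh t) τ = 0)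
    (hsemi2 : ∀ t ∈ Set.Icc (0:ℝ) T, ∀ w : V, c (vh' t) w - b w (σh t) = ⟪f t, w⟫) :
    ∀ t ∈ Set.Icc (0:ℝ) T,
      a (σhat t - σh t) (σhat t - σh t) + c (vhat t - vh t) (vhat t - vh t) ≤
        Real.exp T * (a (σhat 0 - σh 0) (σhat 0 - σh 0) + c (vhat 0 - vh 0) (vhat 0 - vh 0) +
          ∫ s in (0:ℝ)..T,
            (a (σhat' s - σ' s) (σhat' s - σ' s) + c (vhat' s - v' s) (vhat' s - v' s))) := by
  intro t ht
  have henergy : ∀ r ∈ Set.Icc (0 : ℝ) T,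
      2 * a (σhat' r - σh' r) (σhat r - σh r) + 2 * c (vhat' r - vh' r) (vhat r - vh r) ≤
        (a (σhat r - σh r) (σhat r - σh r) + c (vhat r - vh r) (vhat r - vh r)) +
          (a (σhat' r - σ' r) (σhat' r - σ' r) + c (vhat' r - v' r) (vhat' r - v' r)) := by
    intro r hr
    have ha := a.two_mul_apply_le_add_apply_self ha_symm ha_nonneg
      (σhat' r - σ' r) (σhat r - σh r)
    have hc := c.two_mul_apply_le_add_apply_self hc_symm hc_nonneg
      (vhat' r - v' r) (vhat r - vh r)
    have hpos := ha_nonneg (σhat r - σh r)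
    have hσerr : a (σhat' r - σh' r) (σhat r - σh r) =
        a (σhat' r - σ' r) (σhat r - σh r) - a (σhat r - σh r) (σhat r - σh r) -
          b (vhat r - vh r) (σhat r - σh r) := by
      have h₁ := hproj1 r hr (σhat r - σh r)
      have h₂ := hsemi1 r hr (σhat r - σh r)
      simp only [LinearMap.map_sub₂]
      linarith
    have hverr : c (vhat' r - vh' r) (vhat r - vh r) =
        c (vhat' r - v' r) (vhat r - vh r) + b (vhat r - vh r) (σhat r - σh r) := by
      have h₁ := hproj2 r hr (vhat r - vh r)
      have h₂ := hsemi2 r hr (vhat r - vh r)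
      generalize vhat r - vh r = w at *
      simp only [map_sub, LinearMap.sub_apply]
      linarith
    linarith
  have hsource_nonneg : ∀ s, 0 ≤
      a (σhat' s - σ' s) (σhat' s - σ' s) + c (vhat' s - v' s) (vhat' s - v' s) :=
    fun s => add_nonneg (ha_nonneg _) (hc_nonneg _)
  have hsource : ContinuousOn (fun s =>
      a (σhat' s - σ' s) (σhat' s - σ' s) + c (vhat' s - v' s) (vhat' s - v' s))
      (Set.Icc 0 T) :=
    (a.continuousOn_apply_self (hσhat'.sub hσ')).add (c.continuousOn_apply_self (hvhat'.sub hv'))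
  have hgronwall := le_exp_mul_add_integral_of_deriv_le
    (fun r hr => (a.hasDerivWithinAt_apply_self ha_symm ((hσhat r hr).sub (hσh r hr))).add
      (c.hasDerivWithinAt_apply_self hc_symm ((hvhat r hr).sub (hvh r hr))))
    hsource (fun s _ => hsource_nonneg s) henergy ht
  refine hgronwall.trans ?_
  have hinit : 0 ≤ a (σhat 0 - σh 0) (σhat 0 - σh 0) + c (vhat 0 - vh 0) (vhat 0 - vh 0) :=
    add_nonneg (ha_nonneg _) (hc_nonneg _)
  refine mul_le_mul (Real.exp_le_exp.2 ht.2) (add_le_add_right ?_ _)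
    (add_nonneg hinit (intervalIntegral.integral_nonneg ht.1 fun s _ => hsource_nonneg s))
    (Real.exp_nonneg T)
  exact intervalIntegral.integral_mono_interval le_rfl ht.1 ht.2
    (Filter.Eventually.of_forall hsource_nonneg)
    (ContinuousOn.intervalIntegrable (by rwa [Set.uIcc_of_le hT.le]))
end

section
/- Let H and V be finite-dimensional real vector spaces, with V a real inner product space with inner product ⟨·,·⟩. Let a : H × H → ℝ and c : V × V → ℝ be symmetric positive definite bilinear forms, let b : V × H → ℝ be bilinear, and let Δt > 0. Then, for any given (σⁿ, vⁿ) ∈ H × V and any f ∈ V, there exists a unique pair (σ^{n+1}, v^{n+1}) ∈ H × V such that for all τ ∈ H and all w ∈ V: a((σ^{n+1} − σⁿ)/Δt, τ) + a((σ^{n+1} + σⁿ)/2, τ) + b((v^{n+1} + vⁿ)/2, τ) = 0 and c((v^{n+1} − vⁿ)/Δt, w) − b(w, (σ^{n+1} + σⁿ)/2) = ⟨f, w⟩. -/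
open scoped RealInnerProductSpace

/-- A bilinear form on a finite-dimensional real space that is positive on the diagonal away from
zero represents every linear functional uniquely. -/
theorem LinearMap.existsUnique_eq_of_pos {E : Type*} [AddCommGroup E] [Module ℝ E]
    [FiniteDimensional ℝ E] (B : E →ₗ[ℝ] E →ₗ[ℝ] ℝ) (hB : ∀ x, x ≠ 0 → 0 < B x x)
    (l : E →ₗ[ℝ] ℝ) : ∃! x, B x = l := by
  have hinj : Function.Injective B := by
    refine (injective_iff_map_eq_zero B).2 fun x hx => ?_
    by_contra hne
    simpa [hx] using hB x hne
  have hsurj : Function.Surjective B :=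
    (LinearMap.injective_iff_surjective_of_finrank_eq_finrank
      (Subspace.dual_finrank_eq (K := ℝ) (V := E)).symm).1 hinj
  exact Function.Bijective.existsUnique ⟨hinj, hsurj⟩ l

/-- Unique solvability of one time step of the Crank–Nicolson fully discrete scheme. -/
theorem crank_nicolson_step_wellposed
    {H V : Type*} [NormedAddCommGroup H] [NormedSpace ℝ H] [FiniteDimensional ℝ H]
    [NormedAddCommGroup V] [InnerProductSpace ℝ V] [FiniteDimensional ℝ V]
    (a : H →ₗ[ℝ] H →ₗ[ℝ] ℝ) (c : V →ₗ[ℝ] V →ₗ[ℝ] ℝ) (b : V →ₗ[ℝ] H →ₗ[ℝ] ℝ)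
    (ha_symm : ∀ x y, a x y = a y x) (ha_pos : ∀ x : H, x ≠ 0 → 0 < a x x)
    (hc_symm : ∀ x y, c x y = c y x) (hc_pos : ∀ x : V, x ≠ 0 → 0 < c x x)
    (Δt : ℝ) (hΔt : 0 < Δt) (σn : H) (vn : V) (f : V) :
    ∃! p : H × V,
      (∀ τ : H, a (Δt⁻¹ • (p.1 - σn)) τ + a ((2:ℝ)⁻¹ • (p.1 + σn)) τ
          + b ((2:ℝ)⁻¹ • (p.2 + vn)) τ = 0) ∧
      (∀ w : V, c (Δt⁻¹ • (p.2 - vn)) w - b w ((2:ℝ)⁻¹ • (p.1 + σn)) = ⟪f, w⟫) := by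
  have hk : 0 < Δt⁻¹ := inv_pos.2 hΔt
  set k := Δt⁻¹
  let fs := LinearMap.fst ℝ H V
  let sn := LinearMap.snd ℝ H V
  let B : H × V →ₗ[ℝ] H × V →ₗ[ℝ] ℝ :=
    (k + 2⁻¹) • a.compl₁₂ fs fs + (2⁻¹ : ℝ) • b.compl₁₂ sn fs + k • c.compl₁₂ sn sn
      - (2⁻¹ : ℝ) • (b.compl₁₂ sn fs).flip
  let l : H × V →ₗ[ℝ] ℝ :=
    ((k - 2⁻¹) • a σn - (2⁻¹ : ℝ) • b vn) ∘ₗ fs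
      + (k • c vn + (2⁻¹ : ℝ) • b.flip σn + innerₗ V f) ∘ₗ sn
  have hBapp (p q : H × V) : B p q =
      (k + 2⁻¹) * a p.1 q.1 + 2⁻¹ * b p.2 q.1 + k * c p.2 q.2 - 2⁻¹ * b q.2 p.1 := by
    simp [B, fs, sn]
  have hlapp (q : H × V) : l q =
      (k - 2⁻¹) * a σn q.1 - 2⁻¹ * b vn q.1
        + (k * c vn q.2 + 2⁻¹ * b q.2 σn + ⟪f, q.2⟫) := by
    simp [l, fs, sn]
  have hB : ∀ p, p ≠ 0 → 0 < B p p := by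
    rintro ⟨σ, v⟩ hp
    have ha0 : 0 ≤ a σ σ := by
      rcases eq_or_ne σ 0 with rfl | h
      · simp
      · exact (ha_pos σ h).le
    rw [hBapp]
    rcases eq_or_ne v 0 with rfl | hv
    · have hσ : σ ≠ 0 := by
        rintro rfl
        exact hp rfl
      have := mul_pos (by positivity : 0 < k + 2⁻¹) (ha_pos σ hσ)
      simpa using this
    · have h₁ := mul_nonneg (by positivity : 0 ≤ k + 2⁻¹) ha0
      have h₂ := mul_pos hk (hc_pos v hv)
      dsimp only
      linarith
  refine (existsUnique_congr fun p => ?_).1 (LinearMap.existsUnique_eq_of_pos B hB l)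
  simp only [map_smul, map_sub, map_add, LinearMap.smul_apply, LinearMap.sub_apply,
    LinearMap.add_apply, smul_eq_mul]
  constructor
  · intro h
    refine ⟨fun τ => ?_, fun w => ?_⟩
    · have := LinearMap.congr_fun h (τ, 0)
      simp only [hBapp, hlapp, map_zero, LinearMap.zero_apply, inner_zero_right] at this
      linarith
    · have := LinearMap.congr_fun h (0, w)
      simp only [hBapp, hlapp, map_zero] at this
      linarith
  · rintro ⟨h₁, h₂⟩
    refine LinearMap.ext fun q => ?_
    rw [hBapp, hlapp]
    linarith [h₁ q.1, h₂ q.2]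
end

section
/- Let H and V be finite-dimensional real vector spaces, with V a real inner product space with inner product ⟨·,·⟩. Let a : H × H → ℝ and c : V × V → ℝ be symmetric bilinear forms, b : V × H → ℝ bilinear, Δt > 0, and M a positive integer. Suppose (σⁿ)_{n=0}^{M} ⊂ H, (vⁿ)_{n=0}^{M} ⊂ V and (f^{n+1/2})_{n=0}^{M−1} ⊂ V satisfy, for every n = 0,…,M−1 and all τ ∈ H, w ∈ V (writing φ^{n+1/2} := (φ^{n+1}+φⁿ)/2 and Δ_tφ^{n+1/2} := (φ^{n+1}−φⁿ)/Δt): a(Δ_tσ^{n+1/2}, τ) + a(σ^{n+1/2}, τ) + b(v^{n+1/2}, τ) = 0 and c(Δ_tv^{n+1/2}, w) − b(w, σ^{n+1/2}) = ⟨f^{n+1/2}, w⟩. Then for every J = 1,…,M: a(σ^J, σ^J) + c(v^J, v^J) + 2Δt Σ_{n=0}^{J−1} a(σ^{n+1/2}, σ^{n+1/2}) = 2Δt Σ_{n=0}^{J−1} ⟨f^{n+1/2}, v^{n+1/2}⟩ + a(σ⁰, σ⁰) + c(v⁰, v⁰). -/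
open scoped RealInnerProductSpace

/-- For a symmetric bilinear form, testing the difference quotient against the midpoint gives the
difference quotient of the quadratic form. -/
theorem two_mul_bilin_diffQuot_midpoint {E : Type*} [AddCommGroup E] [Module ℝ E]
    (B : E →ₗ[ℝ] E →ₗ[ℝ] ℝ) (hB : ∀ x y, B x y = B y x) {t : ℝ} (ht : t ≠ 0) (x y : E) :
    2 * t * B (t⁻¹ • (x - y)) ((2:ℝ)⁻¹ • (x + y)) = B x x - B y y := by
  simp only [map_smul, map_sub, map_add, LinearMap.smul_apply, LinearMap.sub_apply, smul_eq_mul,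
    hB y x]
  field_simp
  ring

/-- Discrete energy identity for the Crank–Nicolson fully discrete scheme. -/
theorem discrete_energy_identity
    {H V : Type*} [NormedAddCommGroup H] [NormedSpace ℝ H] [FiniteDimensional ℝ H]
    [NormedAddCommGroup V] [InnerProductSpace ℝ V] [FiniteDimensional ℝ V]
    (a : H →ₗ[ℝ] H →ₗ[ℝ] ℝ) (c : V →ₗ[ℝ] V →ₗ[ℝ] ℝ) (b : V →ₗ[ℝ] H →ₗ[ℝ] ℝ)
    (ha_symm : ∀ x y, a x y = a y x) (hc_symm : ∀ x y, c x y = c y x)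
    (Δt : ℝ) (hΔt : 0 < Δt) (M : ℕ) (hM : 0 < M)
    (σ : ℕ → H) (v : ℕ → V) (f : ℕ → V)
    (hscheme : ∀ n < M,
      (∀ τ : H, a (Δt⁻¹ • (σ (n+1) - σ n)) τ + a ((2:ℝ)⁻¹ • (σ (n+1) + σ n)) τ
          + b ((2:ℝ)⁻¹ • (v (n+1) + v n)) τ = 0) ∧
      (∀ w : V, c (Δt⁻¹ • (v (n+1) - v n)) w - b w ((2:ℝ)⁻¹ • (σ (n+1) + σ n))
          = ⟪f n, w⟫)) :
    ∀ J : ℕ, 1 ≤ J → J ≤ M →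
      a (σ J) (σ J) + c (v J) (v J)
        + 2 * Δt * ∑ n ∈ Finset.range J,
          a ((2:ℝ)⁻¹ • (σ (n+1) + σ n)) ((2:ℝ)⁻¹ • (σ (n+1) + σ n))
      = 2 * Δt * (∑ n ∈ Finset.range J, ⟪f n, (2:ℝ)⁻¹ • (v (n+1) + v n)⟫)
        + a (σ 0) (σ 0) + c (v 0) (v 0) := by
  intro J _ hJ
  have step : ∀ n < M,
      2 * Δt * ⟪f n, (2:ℝ)⁻¹ • (v (n+1) + v n)⟫
        - 2 * Δt * a ((2:ℝ)⁻¹ • (σ (n+1) + σ n)) ((2:ℝ)⁻¹ • (σ (n+1) + σ n))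
      = (a (σ (n+1)) (σ (n+1)) + c (v (n+1)) (v (n+1))) - (a (σ n) (σ n) + c (v n) (v n)) := by
    intro n hn
    obtain ⟨h₁, h₂⟩ := hscheme n hn
    linear_combination
      two_mul_bilin_diffQuot_midpoint a ha_symm hΔt.ne' (σ (n+1)) (σ n)
        + two_mul_bilin_diffQuot_midpoint c hc_symm hΔt.ne' (v (n+1)) (v n)
        - 2 * Δt * h₁ ((2:ℝ)⁻¹ • (σ (n+1) + σ n))
        - 2 * Δt * h₂ ((2:ℝ)⁻¹ • (v (n+1) + v n))
  have total := Finset.sum_congr rfl fun n hn => step n ((Finset.mem_range.mp hn).trans_le hJ)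
  rw [Finset.sum_range_sub (fun n => a (σ n) (σ n) + c (v n) (v n)), Finset.sum_sub_distrib,
    ← Finset.mul_sum, ← Finset.mul_sum] at total
  linear_combination -total
end

section
/- Let H and V be finite-dimensional real vector spaces, with V a real inner product space with inner product ⟨·,·⟩. Let a : H × H → ℝ and c : V × V → ℝ be symmetric positive semidefinite bilinear forms with seminorms ‖τ‖_a := a(τ,τ)^{1/2} and ‖w‖_c := c(w,w)^{1/2}, let b : V × H → ℝ be bilinear, let Δt > 0 and M be a positive integer. Suppose (σⁿ)_{n=0}^{M} ⊂ H, (vⁿ)_{n=0}^{M} ⊂ V and (f^{n+1/2})_{n=0}^{M−1} ⊂ V satisfy, for every n = 0,…,M−1 and all τ ∈ H, w ∈ V (writing φ^{n+1/2} := (φ^{n+1}+φⁿ)/2 and Δ_tφ^{n+1/2} := (φ^{n+1}−φⁿ)/Δt): a(Δ_tσ^{n+1/2}, τ) + a(σ^{n+1/2}, τ) + b(v^{n+1/2}, τ) = 0 and c(Δ_tv^{n+1/2}, w) − b(w, σ^{n+1/2}) = ⟨f^{n+1/2}, w⟩. Then for every J = 1,…,M: ‖σ^J‖_a² + ‖v^J‖_c²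 ≤ 2Δt Σ_{n=0}^{J−1} ⟨f^{n+1/2}, v^{n+1/2}⟩ + ‖σ⁰‖_a² + ‖v⁰‖_c². -/
open scoped RealInnerProductSpace

/-- For a symmetric bilinear form, pairing a difference quotient with the midpoint gives the
difference quotient of the associated quadratic form. -/
theorem two_mul_apply_difference_quotient_midpoint {E : Type*} [AddCommGroup E] [Module ℝ E]
    (B : E →ₗ[ℝ] E →ₗ[ℝ] ℝ) (hB : ∀ x y, B x y = B y x) {k : ℝ} (hk : k ≠ 0) (x y : E) :
    2 * k * B (k⁻¹ • (x - y)) ((2:ℝ)⁻¹ • (x + y)) = B x x - B y y := by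
  simp only [map_smul, map_add, map_sub, LinearMap.smul_apply, LinearMap.sub_apply, smul_eq_mul]
  rw [hB y x]
  field_simp
  ring

/-- Stability estimate (Lemma 4.2) for the Crank–Nicolson fully discrete scheme. -/
theorem crank_nicolson_stability
    {H V : Type*} [NormedAddCommGroup H] [NormedSpace ℝ H] [FiniteDimensional ℝ H]
    [NormedAddCommGroup V] [InnerProductSpace ℝ V] [FiniteDimensional ℝ V]
    (a : H →ₗ[ℝ] H →ₗ[ℝ] ℝ) (c : V →ₗ[ℝ] V →ₗ[ℝ] ℝ) (b : V →ₗ[ℝ] H →ₗ[ℝ] ℝ)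
    (ha_symm : ∀ x y, a x y = a y x) (ha_nonneg : ∀ x, 0 ≤ a x x)
    (hc_symm : ∀ x y, c x y = c y x) (hc_nonneg : ∀ x, 0 ≤ c x x)
    (Δt : ℝ) (hΔt : 0 < Δt) (M : ℕ) (hM : 0 < M)
    (σ : ℕ → H) (v : ℕ → V) (f : ℕ → V)
    (hscheme : ∀ n < M,
      (∀ τ : H, a (Δt⁻¹ • (σ (n+1) - σ n)) τ + a ((2:ℝ)⁻¹ • (σ (n+1) + σ n)) τ
          + b ((2:ℝ)⁻¹ • (v (n+1) + v n)) τ = 0) ∧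
      (∀ w : V, c (Δt⁻¹ • (v (n+1) - v n)) w - b w ((2:ℝ)⁻¹ • (σ (n+1) + σ n))
          = ⟪f n, w⟫)) :
    ∀ J : ℕ, 1 ≤ J → J ≤ M →
      a (σ J) (σ J) + c (v J) (v J)
        ≤ 2 * Δt * (∑ n ∈ Finset.range J, ⟪f n, (2:ℝ)⁻¹ • (v (n+1) + v n)⟫)
          + a (σ 0) (σ 0) + c (v 0) (v 0) := by
  intro J hJ_pos hJ
  clear hJ_pos
  induction J with
  | zero => simp
  | succ n ih =>
    obtain ⟨hσ, hv⟩ := hscheme n hJ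
    have hσ' := hσ ((2:ℝ)⁻¹ • (σ (n+1) + σ n))
    have hv' := hv ((2:ℝ)⁻¹ • (v (n+1) + v n))
    have ea := two_mul_apply_difference_quotient_midpoint a ha_symm hΔt.ne' (σ (n+1)) (σ n)
    have ec := two_mul_apply_difference_quotient_midpoint c hc_symm hΔt.ne' (v (n+1)) (v n)
    have dissipation := mul_nonneg hΔt.le (ha_nonneg ((2:ℝ)⁻¹ • (σ (n+1) + σ n)))
    rw [Finset.sum_range_succ, mul_add]
    linear_combination ih (by omega) + 2 * dissipation + 2 * Δt * hσ' + 2 * Δt * hv' - ea - ec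
end

section
/- Let H and V be finite-dimensional real vector spaces, with V a real inner product space with inner product ⟨·,·⟩ and norm ‖·‖. Let a : H × H → ℝ be a symmetric positive semidefinite bilinear form with ‖τ‖_a := a(τ,τ)^{1/2}, let c : V × V → ℝ be a symmetric bilinear form satisfying ρ₀‖w‖² ≤ c(w,w) for all w ∈ V with a constant ρ₀ > 0, write ‖w‖_c := c(w,w)^{1/2}, and let b : V × H → ℝ be bilinear. Let M be a positive integer, 0 < Δt < 1, T := MΔt, and suppose (σⁿ)_{n=0}^{M} ⊂ H, (vⁿ)_{n=0}^{M} ⊂ V and (f^{n+1/2})_{n=0}^{M−1} ⊂ V satisfy, for every n = 0,…,M−1 and all τ ∈ H, w ∈ V (writing φ^{n+1/2} := (φ^{n+1}+φⁿ)/2 and Δ_tφ^{n+1/2} := (φ^{n+1}−φⁿ)/Δt): a(Δ_tσ^{n+1/2}, τ) + a(σ^{n+1/2}, τ) + b(v^{n+1/2}, τ) = 0 and c(Δ_tv^{n+1/2}, w) − b(w, σ^{n+1/2}) = ⟨f^{n+1/2}, w⟩. Then for every J = 1,…,M: ‖v^J‖_c² + ‖σ^J‖_a² ≤ 2 · ( ‖σ⁰‖_a²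 + ‖v⁰‖_c² + T ρ₀^{-1} max_{0≤n≤M−1} ‖f^{n+1/2}‖² ) · exp(2T). -/
open scoped RealInnerProductSpace

/-- The difference quotient of a symmetric form, tested with the midpoint, is the difference
quotient of half its quadratic form. -/
lemma symm_form_diffQuot_midpoint {E : Type*} [AddCommGroup E] [Module ℝ E]
    (B : E →ₗ[ℝ] E →ₗ[ℝ] ℝ) (hB : ∀ x y, B x y = B y x) (t : ℝ) (x y : E) :
    B (t⁻¹ • (x - y)) ((2 : ℝ)⁻¹ • (x + y)) = t⁻¹ * ((B x x - B y y) / 2) := by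
  simp only [map_smul, map_add, map_sub, LinearMap.smul_apply, LinearMap.sub_apply,
    smul_eq_mul, hB y x]
  ring

/-- Convexity of a nonnegative quadratic form at the midpoint. -/
lemma form_midpoint_le {E : Type*} [AddCommGroup E] [Module ℝ E]
    (B : E →ₗ[ℝ] E →ₗ[ℝ] ℝ) (hB : ∀ x, 0 ≤ B x x) (x y : E) :
    B ((2 : ℝ)⁻¹ • (x + y)) ((2 : ℝ)⁻¹ • (x + y)) ≤ (B x x + B y y) / 2 := by
  have h := hB (x - y)
  simp only [map_smul, map_add, map_sub, LinearMap.smul_apply, LinearMap.add_apply,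
    LinearMap.sub_apply, smul_eq_mul] at h ⊢
  linarith

/-- Weighted Cauchy–Schwarz and Young inequality. -/
lemma two_mul_inner_le_inv_mul_add {V : Type*} [NormedAddCommGroup V] [InnerProductSpace ℝ V]
    {ρ : ℝ} (hρ : 0 < ρ) (x y : V) :
    2 * ⟪x, y⟫ ≤ ρ⁻¹ * ‖x‖ ^ 2 + ρ * ‖y‖ ^ 2 := by
  have hxy := real_inner_le_norm x y
  have hsq : 0 ≤ ρ⁻¹ * (‖x‖ - ρ * ‖y‖) ^ 2 := by positivity
  have hexpand : ρ⁻¹ * (‖x‖ - ρ * ‖y‖) ^ 2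
      = ρ⁻¹ * ‖x‖ ^ 2 - 2 * (‖x‖ * ‖y‖) + ρ * ‖y‖ ^ 2 := by
    field_simp
    ring
  linarith

/-- Discrete Grönwall inequality for a Crank–Nicolson energy estimate. -/
lemma le_exp_mul_of_midpoint_step {E : ℕ → ℝ} {t G : ℝ} {M : ℕ} (ht : 0 < t) (ht1 : t < 1)
    (hG : 0 ≤ G) (hE : ∀ n, 0 ≤ E n)
    (hstep : ∀ n < M, E (n + 1) - E n ≤ t * (G + (E (n + 1) + E n) / 2)) :
    ∀ n ≤ M, E n ≤ Real.exp (2 * (n * t)) * (E 0 + 2 * (n * t) * G) := by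
  intro n
  induction n with
  | zero => intro _; simp
  | succ n ih =>
    intro hn
    have hgrow : E (n + 1) ≤ (1 + 2 * t) * E n + 2 * t * G := by
      have h := hstep n hn
      have htE : 0 ≤ t * (1 - t) * E n :=
        mul_nonneg (mul_nonneg ht.le (by linarith)) (hE n)
      have htG : 0 ≤ t * (1 - t) * G := mul_nonneg (mul_nonneg ht.le (by linarith)) hG
      refine le_of_mul_le_mul_left ?_ (show 0 < 1 - t / 2 by linarith)
      linarith
    have hexp : 1 + 2 * t ≤ Real.exp (2 * t) := by
      linarith [Real.add_one_le_exp (2 * t)]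
    have hone : 1 ≤ Real.exp (2 * ((n + 1 : ℕ) * t)) := Real.one_le_exp (by positivity)
    have hsplit : Real.exp (2 * ((n + 1 : ℕ) * t))
        = Real.exp (2 * t) * Real.exp (2 * (n * t)) := by
      rw [← Real.exp_add]
      push_cast
      ring_nf
    calc E (n + 1) ≤ (1 + 2 * t) * E n + 2 * t * G := hgrow
      _ ≤ Real.exp (2 * t) * (Real.exp (2 * (n * t)) * (E 0 + 2 * (n * t) * G))
          + Real.exp (2 * ((n + 1 : ℕ) * t)) * (2 * t * G) := by
        refine add_le_add ?_ (le_mul_of_one_le_left (by positivity) hone)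
        exact mul_le_mul hexp (ih (by omega)) (hE n) (Real.exp_pos _).le
      _ = Real.exp (2 * ((n + 1 : ℕ) * t)) * (E 0 + 2 * ((n + 1 : ℕ) * t) * G) := by
        rw [hsplit]
        push_cast
        ring

/-- Unconditional stability (Theorem 4.1) of the Crank–Nicolson fully discrete scheme. -/
theorem crank_nicolson_unconditional_stability
    {H V : Type*} [NormedAddCommGroup H] [NormedSpace ℝ H] [FiniteDimensional ℝ H]
    [NormedAddCommGroup V] [InnerProductSpace ℝ V] [FiniteDimensional ℝ V]
    (a : H →ₗ[ℝ] H →ₗ[ℝ] ℝ) (c : V →ₗ[ℝ] V →ₗ[ℝ] ℝ) (b : V →ₗ[ℝ] H →ₗ[ℝ] ℝ)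
    (ha_symm : ∀ x y, a x y = a y x) (ha_nonneg : ∀ x, 0 ≤ a x x)
    (hc_symm : ∀ x y, c x y = c y x)
    (ρ₀ : ℝ) (hρ₀ : 0 < ρ₀) (hc_lower : ∀ w : V, ρ₀ * ‖w‖ ^ 2 ≤ c w w)
    (M : ℕ) (hM : 0 < M) (Δt : ℝ) (hΔt : 0 < Δt) (hΔt1 : Δt < 1)
    (T : ℝ) (hT : T = M * Δt)
    (σ : ℕ → H) (v : ℕ → V) (f : ℕ → V)
    (hscheme : ∀ n < M,
      (∀ τ : H, a (Δt⁻¹ • (σ (n+1) - σ n)) τ + a ((2:ℝ)⁻¹ • (σ (n+1) + σ n)) τ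
          + b ((2:ℝ)⁻¹ • (v (n+1) + v n)) τ = 0) ∧
      (∀ w : V, c (Δt⁻¹ • (v (n+1) - v n)) w - b w ((2:ℝ)⁻¹ • (σ (n+1) + σ n))
          = ⟪f n, w⟫)) :
    ∀ J : ℕ, 1 ≤ J → J ≤ M →
      c (v J) (v J) + a (σ J) (σ J)
        ≤ 2 * (a (σ 0) (σ 0) + c (v 0) (v 0)
            + T * ρ₀⁻¹ * (Finset.range M).sup' (Finset.nonempty_range_iff.mpr hM.ne')
                (fun n => ‖f n‖ ^ 2))
          * Real.exp (2 * T) := by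
  intro J _ hJM
  set F := (Finset.range M).sup' (Finset.nonempty_range_iff.mpr hM.ne') (fun n => ‖f n‖ ^ 2)
  have hfF : ∀ n < M, ‖f n‖ ^ 2 ≤ F := fun n hn =>
    Finset.le_sup' (fun n => ‖f n‖ ^ 2) (Finset.mem_range.mpr hn)
  have hF0 : 0 ≤ F := (sq_nonneg _).trans (hfF 0 hM)
  have hc_nonneg : ∀ w, 0 ≤ c w w := fun w => le_trans (by positivity) (hc_lower w)
  have hE : ∀ n, 0 ≤ c (v n) (v n) + a (σ n) (σ n) := fun n =>
    add_nonneg (hc_nonneg _) (ha_nonneg _)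
  have hstep : ∀ n < M,
      (c (v (n + 1)) (v (n + 1)) + a (σ (n + 1)) (σ (n + 1))) - (c (v n) (v n) + a (σ n) (σ n))
        ≤ Δt * (ρ₀⁻¹ * F + ((c (v (n + 1)) (v (n + 1)) + a (σ (n + 1)) (σ (n + 1)))
          + (c (v n) (v n) + a (σ n) (σ n))) / 2) := by
    intro n hn
    obtain ⟨hσ, hv⟩ := hscheme n hn
    replace hσ := hσ ((2 : ℝ)⁻¹ • (σ (n + 1) + σ n))
    replace hv := hv ((2 : ℝ)⁻¹ • (v (n + 1) + v n))
    rw [symm_form_diffQuot_midpoint a ha_symm] at hσ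
    rw [symm_form_diffQuot_midpoint c hc_symm] at hv
    have ha_mid := ha_nonneg ((2 : ℝ)⁻¹ • (σ (n + 1) + σ n))
    have hc_mid := hc_lower ((2 : ℝ)⁻¹ • (v (n + 1) + v n))
    have hc_conv := form_midpoint_le c hc_nonneg (v (n + 1)) (v n)
    have hyoung := two_mul_inner_le_inv_mul_add hρ₀ (f n) ((2 : ℝ)⁻¹ • (v (n + 1) + v n))
    have hf : ρ₀⁻¹ * ‖f n‖ ^ 2 ≤ ρ₀⁻¹ * F := by
      gcongr
      exact hfF n hn
    have hσ_succ := ha_nonneg (σ (n + 1))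
    have hσ_n := ha_nonneg (σ n)
    rw [← inv_mul_le_iff₀ hΔt]
    linarith
  have hbound := le_exp_mul_of_midpoint_step
    (E := fun n => c (v n) (v n) + a (σ n) (σ n)) hΔt hΔt1 (by positivity) hE hstep J hJM
  have hJT : (J : ℝ) * Δt ≤ T := by
    rw [hT]
    gcongr
  have hE0 := hE 0
  calc c (v J) (v J) + a (σ J) (σ J)
      ≤ Real.exp (2 * (J * Δt))
          * (c (v 0) (v 0) + a (σ 0) (σ 0) + 2 * (J * Δt) * (ρ₀⁻¹ * F)) := hbound
    _ ≤ Real.exp (2 * T) * (c (v 0) (v 0) + a (σ 0) (σ 0) + 2 * T * (ρ₀⁻¹ * F)) := by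
      gcongr
    _ ≤ Real.exp (2 * T) * (2 * (c (v 0) (v 0) + a (σ 0) (σ 0)) + 2 * T * (ρ₀⁻¹ * F)) := by
      gcongr
      linarith
    _ = 2 * (a (σ 0) (σ 0) + c (v 0) (v 0) + T * ρ₀⁻¹ * F) * Real.exp (2 * T) := by ring
end

section
/- Let H and V be finite-dimensional real normed vector spaces with norms ‖·‖. Let a : H × H → ℝ be a symmetric bilinear form satisfying M₀‖τ‖² ≤ a(τ,τ) and |a(σ,τ)| ≤ M₁‖σ‖‖τ‖ for all σ, τ ∈ H, and let c : V × V → ℝ be a symmetric bilinear form satisfying ρ₀‖w‖² ≤ c(w,w) and |c(v,w)| ≤ ρ₁‖v‖‖w‖ for all v, w ∈ V, where 0 < M₀ ≤ M₁ and 0 < ρ₀ ≤ ρ₁; write ‖τ‖_a := a(τ,τ)^{1/2}, ‖w‖_c := c(w,w)^{1/2}. Let b : V × H → ℝ be bilinear, Δt > 0, and M a positive integer. Suppose (ψⁿ)_{n=0}^{M} ⊂ H, (rⁿ)_{n=0}^{M} ⊂ V, (g_j)_{j=0}^{M−1} ⊂ H and (d_j)_{j=0}^{M−1} ⊂ V satisfy,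 for every j = 0,…,M−1 and all τ ∈ H, w ∈ V (writing φ^{j+1/2} := (φ^{j+1}+φ^j)/2 and Δ_tφ^{j+1/2} := (φ^{j+1}−φ^j)/Δt): a(ψ^{j+1/2}, τ) + b(r^{j+1/2}, τ) = −a(Δ_tψ^{j+1/2}, τ) + a(g_j, τ) and b(w, ψ^{j+1/2}) = c(Δ_tr^{j+1/2}, w) − c(d_j, w). Then there exists a constant C > 0, depending only on M₀, M₁, ρ₀ and ρ₁, such that max_{1≤j≤M} ‖ψ^j‖_a + max_{1≤j≤M} ‖r^j‖_c ≤ C · ( ‖ψ⁰‖ + ‖r⁰‖ + Δt Σ_{j=0}^{M−1} ( ‖g_j‖ + ‖d_j‖ ) ). -/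
/-- A bounded coercive bilinear form satisfies a mixed Cauchy–Schwarz inequality between the
norm and the energy seminorm. -/
theorem bilin_le_norm_mul_sqrt_self {E : Type*} [NormedAddCommGroup E] [NormedSpace ℝ E]
    {m K : ℝ} (hm : 0 < m) (hK : 0 ≤ K) (a : E →ₗ[ℝ] E →ₗ[ℝ] ℝ)
    (hcoer : ∀ x, m * ‖x‖ ^ 2 ≤ a x x) (hbdd : ∀ x y, |a x y| ≤ K * ‖x‖ * ‖y‖) (x y : E) :
    a x y ≤ K / √m * ‖x‖ * √(a y y) := by
  have hs : 0 < √m := Real.sqrt_pos.mpr hm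
  have hy : √m * ‖y‖ ≤ √(a y y) := by
    apply Real.le_sqrt_of_sq_le
    rw [mul_pow, Real.sq_sqrt hm.le]
    exact hcoer y
  calc a x y ≤ K * ‖x‖ * ‖y‖ := (le_abs_self _).trans (hbdd x y)
    _ = K / √m * ‖x‖ * (√m * ‖y‖) := by field_simp
    _ ≤ K / √m * ‖x‖ * √(a y y) := by gcongr

/-- The energy seminorm of a bounded coercive bilinear form is bounded by the norm. -/
theorem sqrt_bilin_self_le_norm {E : Type*} [NormedAddCommGroup E] [NormedSpace ℝ E]
    {m K : ℝ} (hm : 0 < m) (hK : 0 ≤ K) (a : E →ₗ[ℝ] E →ₗ[ℝ] ℝ)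
    (hcoer : ∀ x, m * ‖x‖ ^ 2 ≤ a x x) (hbdd : ∀ x y, |a x y| ≤ K * ‖x‖ * ‖y‖) (x : E) :
    √(a x x) ≤ K / √m * ‖x‖ := by
  have h := bilin_le_norm_mul_sqrt_self hm hK a hcoer hbdd x x
  have hx : 0 ≤ a x x := le_trans (by positivity) (hcoer x)
  have hsq := Real.mul_self_sqrt hx
  rcases (Real.sqrt_nonneg (a x x)).eq_or_lt with h0 | h0
  · rw [← h0]
    positivity
  · exact le_of_mul_le_mul_right (by linarith) h0

/-- The energy identity of one Crank–Nicolson step. -/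
theorem crank_nicolson_energy_identity {H V : Type*} [AddCommGroup H] [Module ℝ H]
    [AddCommGroup V] [Module ℝ V]
    (a : H →ₗ[ℝ] H →ₗ[ℝ] ℝ) (c : V →ₗ[ℝ] V →ₗ[ℝ] ℝ) (b : V →ₗ[ℝ] H →ₗ[ℝ] ℝ)
    (ha : ∀ x y, a x y = a y x) (hc : ∀ x y, c x y = c y x) {Δt : ℝ} (hΔt : Δt ≠ 0)
    (ψ ψ' g : H) (r r' d : V)
    (h₁ : ∀ τ : H, a ((2:ℝ)⁻¹ • (ψ' + ψ)) τ + b ((2:ℝ)⁻¹ • (r' + r)) τ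
      = -(a (Δt⁻¹ • (ψ' - ψ)) τ) + a g τ)
    (h₂ : ∀ w : V, b w ((2:ℝ)⁻¹ • (ψ' + ψ)) = c (Δt⁻¹ • (r' - r)) w - c d w) :
    (a ψ' ψ' + c r' r') - (a ψ ψ + c r r)
      = Δt * (a g ψ' + a g ψ + c d r' + c d r)
        - 2 * Δt * a ((2:ℝ)⁻¹ • (ψ' + ψ)) ((2:ℝ)⁻¹ • (ψ' + ψ)) := by
  have e₁ := h₁ ((2:ℝ)⁻¹ • (ψ' + ψ))
  rw [h₂] at e₁
  generalize a ((2:ℝ)⁻¹ • (ψ' + ψ)) ((2:ℝ)⁻¹ • (ψ' + ψ)) = q at e₁ ⊢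
  simp only [map_smul, map_add, map_sub, LinearMap.smul_apply,
    LinearMap.sub_apply, smul_eq_mul] at e₁
  rw [ha ψ ψ', hc r r'] at e₁
  field_simp at e₁
  linarith

/-- One step of a discrete Grönwall argument on the square root of an energy. -/
theorem le_add_of_sq_sub_sq_le {x y k : ℝ} (hx : 0 ≤ x) (hk : 0 ≤ k)
    (h : y ^ 2 - x ^ 2 ≤ k * (y + x)) : y ≤ x + k := by
  by_contra! hlt
  nlinarith


/-- Error-propagation estimate (Lemma 4.3) for the Crank–Nicolson fully discrete
scheme: the constant `C` depends only on the form bounds `M₀, M₁, ρ₀, ρ₁`. -/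
theorem crank_nicolson_error_propagation
    (M₀ M₁ ρ₀ ρ₁ : ℝ) (hM₀ : 0 < M₀) (hM₀₁ : M₀ ≤ M₁) (hρ₀ : 0 < ρ₀) (hρ₀₁ : ρ₀ ≤ ρ₁) :
    ∃ C : ℝ, 0 < C ∧
      ∀ (H V : Type) (_ : NormedAddCommGroup H) (_ : NormedSpace ℝ H)
        (_ : FiniteDimensional ℝ H) (_ : NormedAddCommGroup V) (_ : NormedSpace ℝ V)
        (_ : FiniteDimensional ℝ V)
        (a : H →ₗ[ℝ] H →ₗ[ℝ] ℝ) (c : V →ₗ[ℝ] V →ₗ[ℝ] ℝ) (b : V →ₗ[ℝ] H →ₗ[ℝ] ℝ),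
        (∀ x y, a x y = a y x) →
        (∀ τ : H, M₀ * ‖τ‖ ^ 2 ≤ a τ τ) →
        (∀ σ τ : H, |a σ τ| ≤ M₁ * ‖σ‖ * ‖τ‖) →
        (∀ x y, c x y = c y x) →
        (∀ w : V, ρ₀ * ‖w‖ ^ 2 ≤ c w w) →
        (∀ v w : V, |c v w| ≤ ρ₁ * ‖v‖ * ‖w‖) →
        ∀ (Δt : ℝ), 0 < Δt → ∀ (M : ℕ) (hM : 1 ≤ M),
        ∀ (ψ : ℕ → H) (r : ℕ → V) (g : ℕ → H) (d : ℕ → V),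
        (∀ j < M,
          (∀ τ : H, a ((2:ℝ)⁻¹ • (ψ (j+1) + ψ j)) τ + b ((2:ℝ)⁻¹ • (r (j+1) + r j)) τ
              = -(a (Δt⁻¹ • (ψ (j+1) - ψ j)) τ) + a (g j) τ) ∧
          (∀ w : V, b w ((2:ℝ)⁻¹ • (ψ (j+1) + ψ j))
              = c (Δt⁻¹ • (r (j+1) - r j)) w - c (d j) w)) →
        (Finset.Icc 1 M).sup' (Finset.nonempty_Icc.mpr hM)
            (fun j => Real.sqrt (a (ψ j) (ψ j)))
          + (Finset.Icc 1 M).sup' (Finset.nonempty_Icc.mpr hM)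
            (fun j => Real.sqrt (c (r j) (r j)))
          ≤ C * (‖ψ 0‖ + ‖r 0‖ + Δt * ∑ j ∈ Finset.range M, (‖g j‖ + ‖d j‖)) := by
  have hM₁ : 0 < M₁ := hM₀.trans_le hM₀₁
  have hρ₁ : 0 < ρ₁ := hρ₀.trans_le hρ₀₁
  set A : ℝ := M₁ / √M₀ with hA
  set B : ℝ := ρ₁ / √ρ₀ with hB
  have hA0 : 0 < A := div_pos hM₁ (Real.sqrt_pos.mpr hM₀)
  have hB0 : 0 < B := div_pos hρ₁ (Real.sqrt_pos.mpr hρ₀)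
  refine ⟨2 * (A + B), by positivity, ?_⟩
  intro H V _ _ _ _ _ _ a c b ha hacoer habdd hc hccoer hcbdd Δt hΔt M hM ψ r g d hstep
  have ha0 (x : H) : 0 ≤ a x x := le_trans (by positivity) (hacoer x)
  have hc0 (x : V) : 0 ≤ c x x := le_trans (by positivity) (hccoer x)
  set N : ℕ → ℝ := fun j => √(a (ψ j) (ψ j) + c (r j) (r j)) with hN
  have hN0 (j : ℕ) : 0 ≤ N j := Real.sqrt_nonneg _
  have hNsq (j : ℕ) : N j ^ 2 = a (ψ j) (ψ j) + c (r j) (r j) :=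
    Real.sq_sqrt (add_nonneg (ha0 _) (hc0 _))
  have haN (j : ℕ) : √(a (ψ j) (ψ j)) ≤ N j :=
    Real.sqrt_le_sqrt (le_add_of_nonneg_right (hc0 _))
  have hcN (j : ℕ) : √(c (r j) (r j)) ≤ N j :=
    Real.sqrt_le_sqrt (le_add_of_nonneg_left (ha0 _))
  have hag (x : H) (j : ℕ) : a x (ψ j) ≤ A * ‖x‖ * N j :=
    (bilin_le_norm_mul_sqrt_self hM₀ hM₁.le a hacoer habdd x (ψ j)).trans
      (mul_le_mul_of_nonneg_left (haN j) (by positivity))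
  have hcd (x : V) (j : ℕ) : c x (r j) ≤ B * ‖x‖ * N j :=
    (bilin_le_norm_mul_sqrt_self hρ₀ hρ₁.le c hccoer hcbdd x (r j)).trans
      (mul_le_mul_of_nonneg_left (hcN j) (by positivity))
  have hinit : N 0 ≤ (A + B) * (‖ψ 0‖ + ‖r 0‖) := by
    have h₁ := sqrt_bilin_self_le_norm hM₀ hM₁.le a hacoer habdd (ψ 0)
    have h₂ := sqrt_bilin_self_le_norm hρ₀ hρ₁.le c hccoer hcbdd (r 0)
    have h₃ : N 0 ≤ √(a (ψ 0) (ψ 0)) + √(c (r 0) (r 0)) :=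
      Real.sqrt_le_iff.mpr ⟨by positivity, by
        nlinarith [Real.sq_sqrt (ha0 (ψ 0)), Real.sq_sqrt (hc0 (r 0)),
          mul_nonneg (Real.sqrt_nonneg (a (ψ 0) (ψ 0))) (Real.sqrt_nonneg (c (r 0) (r 0)))]⟩
    nlinarith [mul_nonneg hA0.le (norm_nonneg (r 0)), mul_nonneg hB0.le (norm_nonneg (ψ 0))]
  have hinc (j : ℕ) (hj : j < M) :
      N (j + 1) ≤ N j + Δt * ((A + B) * (‖g j‖ + ‖d j‖)) := by
    apply le_add_of_sq_sub_sq_le (hN0 _) (by positivity)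
    have hE := crank_nicolson_energy_identity a c b ha hc hΔt.ne' (ψ j) (ψ (j + 1)) (g j)
      (r j) (r (j + 1)) (d j) (hstep j hj).1 (hstep j hj).2
    have hq := mul_nonneg (mul_pos two_pos hΔt).le
      (ha0 ((2:ℝ)⁻¹ • (ψ (j + 1) + ψ j)))
    rw [hNsq, hNsq, hE, mul_assoc Δt]
    refine (sub_le_self _ hq).trans (mul_le_mul_of_nonneg_left ?_ hΔt.le)
    have hS : 0 ≤ N (j + 1) + N j := add_nonneg (hN0 _) (hN0 _)
    have h₁ := mul_nonneg (mul_nonneg hA0.le (norm_nonneg (d j))) hS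
    have h₂ := mul_nonneg (mul_nonneg hB0.le (norm_nonneg (g j))) hS
    linarith [hag (g j) (j + 1), hag (g j) j, hcd (d j) (j + 1), hcd (d j) j]
  have hsum (j : ℕ) (hj : j ≤ M) :
      N j ≤ (A + B) * (‖ψ 0‖ + ‖r 0‖ + Δt * ∑ i ∈ Finset.range j, (‖g i‖ + ‖d i‖)) := by
    induction j with
    | zero => simpa using hinit
    | succ j ih =>
      rw [Finset.sum_range_succ]
      linarith [ih (by omega), hinc j (by omega)]
  have hbound (j : ℕ) (hj : j ∈ Finset.Icc 1 M) :
      N j ≤ (A + B) * (‖ψ 0‖ + ‖r 0‖ + Δt * ∑ i ∈ Finset.range M, (‖g i‖ + ‖d i‖)) := by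
    have hjM := (Finset.mem_Icc.mp hj).2
    refine (hsum j hjM).trans ?_
    gcongr
  rw [mul_assoc, two_mul]
  exact add_le_add (Finset.sup'_le _ _ fun j hj => (haN j).trans (hbound j hj))
    (Finset.sup'_le _ _ fun j hj => (hcN j).trans (hbound j hj))
end
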